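/- In the polynomial representation of the type A_2 double affine Hecke algebra with equal parameters, the nonsymmetric Macdonald polynomial E_{s_1s_2ρ} = τ_1^∨ τ_2^∨ τ_0^∨ · 1 for ρ = α_1+α_2 equals t^{1/2} ( X^{s_1s_2ρ} + (1−t)/(1−t²q) + X^{s_1ρ}(1−t)/(1−tq) + t·((1−t)q/(1−t²q))·((1−t)/(1−tq)) + X^{s_2ρ}(1−t)/(1−t²q²) + t·((1−t)q/(1−t²q))·((1−t)/(1−t²q²)) + X^{ρ}·((1−t)/(1−tq))·((1−t)/(1−t²q²)) + ((1−t)q/(1−t²q))·((1−t)/(1−tq))·((1−t)/(1−t²q²)) ) · 1. -/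

import Mathlib

noncomputable section

/-!
In the polynomial representation of the type `A₂` double affine Hecke algebra with equal
parameters, the nonsymmetric Macdonald polynomial `E_{s₁s₂ρ} = τ₁^∨τ₂^∨τ₀^∨·𝟙` for
`ρ = α₁+α₂` has the alcove walk expansion displayed in the paper, with eight terms
corresponding to the eight alcove walks of type `(1,2,0)` beginning at `1`.
-/

/-- The type `A₂` double affine Hecke algebra with equal parameters, together with its
polynomial representation (`Tᵢ·𝟙 = t^{1/2}·𝟙`, `g·𝟙 = 𝟙`).  The scalars `q^{1/3}` and
`t^{1/2}` are units of the coefficient ring `K`. -/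
structure A2DAHARep where
  K : Type
  [commRingK : CommRing K]
  /-- `q^{1/3}` -/
  qc : Kˣ
  /-- `t^{1/2}` -/
  tsq : Kˣ
  H : Type
  [ringH : Ring H]
  [algH : Algebra K H]
  T0 : Hˣ
  T1 : Hˣ
  T2 : Hˣ
  g : Hˣ
  X1 : Hˣ
  X2 : Hˣ
  rel_br01 : T0 * T1 * T0 = T1 * T0 * T1
  rel_br02 : T0 * T2 * T0 = T2 * T0 * T2
  rel_br12 : T1 * T2 * T1 = T2 * T1 * T2
  rel_X : X1 * X2 = X2 * X1
  rel_T1X2 : T1 * X2 = X2 * T1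
  rel_T2X1 : T2 * X1 = X1 * T2
  rel_T1X1 : T1 * X1 * T1 = X1⁻¹ * X2
  rel_T2X2 : T2 * X2 * T2 = X1 * X2⁻¹
  rel_g3 : g * g * g = 1
  rel_gX1 : ((g * X1 : Hˣ) : H) = algebraMap K H (qc : K) * ((X1⁻¹ * X2 * g : Hˣ) : H)
  rel_gX2 : ((g * X2 : Hˣ) : H)
      = algebraMap K H ((qc : K) ^ 2) * ((X1⁻¹ * g : Hˣ) : H)
  rel_gT0 : g * T0 * g⁻¹ = T1
  rel_gT1 : g * T1 * g⁻¹ = T2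
  rel_gT2 : g * T2 * g⁻¹ = T0
  quad0 : ((T0 : H)) ^ 2
      = algebraMap K H ((tsq : K) - ((tsq⁻¹ : Kˣ) : K)) * (T0 : H) + 1
  quad1 : ((T1 : H)) ^ 2
      = algebraMap K H ((tsq : K) - ((tsq⁻¹ : Kˣ) : K)) * (T1 : H) + 1
  quad2 : ((T2 : H)) ^ 2
      = algebraMap K H ((tsq : K) - ((tsq⁻¹ : Kˣ) : K)) * (T2 : H) + 1
  /-- the polynomial representation -/
  M : Type
  [acgM : AddCommGroup M]
  [modM : Module H M]
  /-- the cyclic vector `𝟙` -/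
  one : M
  cyclic : ∀ m : M, ∃ h : H, h • one = m
  T0_one : (T0 : H) • one = algebraMap K H (tsq : K) • one
  T1_one : (T1 : H) • one = algebraMap K H (tsq : K) • one
  T2_one : (T2 : H) • one = algebraMap K H (tsq : K) • one
  g_one : (g : H) • one = one

attribute [instance] A2DAHARep.commRingK A2DAHARep.ringH A2DAHARep.algH
  A2DAHARep.acgM A2DAHARep.modM

namespace A2DAHARep

variable (A : A2DAHARep)

/-- `q = (q^{1/3})³`. -/
def q : A.K := (A.qc : A.K) ^ 3

/-- `t = (t^{1/2})²`. -/
def t : A.K := (A.tsq : A.K) ^ 2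

/-- `Y^{ω₁^∨} = gT₂T₁`. -/
def Y1 : A.Hˣ := A.g * A.T2 * A.T1

/-- `Y^{ω₂^∨} = g²T₁T₂`. -/
def Y2 : A.Hˣ := A.g * A.g * A.T1 * A.T2

/-- `Y^{φ^∨} = Y^{ω₁^∨+ω₂^∨}`, where `φ^∨ = α₁^∨+α₂^∨ = ω₁^∨+ω₂^∨`. -/
def Yφ : A.Hˣ := A.Y1 * A.Y2

/-- `Y^{-α₀^∨} = Y^{φ^∨-d} = qY^{φ^∨}`. -/
def Yma0 : A.H := algebraMap A.K A.H A.q * (A.Yφ : A.H)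

/-- The scalar `t^{-1/2}(1−t)`. -/
def tfac : A.K := ((A.tsq⁻¹ : A.Kˣ) : A.K) * (1 - A.t)

/-- `T₀^∨`, defined by `(T₀^∨)⁻¹ = X^φT₁^∨T₂^∨T₁^∨` with `X^φ = X^{ω₁+ω₂}`. -/
def T0v : A.Hˣ := (A.X1 * A.X2 * A.T1 * A.T2 * A.T1)⁻¹

/-- The intertwiner `τ₀^∨ = T₀^∨ + t^{-1/2}(1−t)/(1−Y^{-α₀^∨})`. -/
def tau0 : A.H :=
  (A.T0v : A.H) + algebraMap A.K A.H A.tfac * Ring.inverse (1 - A.Yma0)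

/-- The symmetrizer
`𝟙₀ = T_{s₁s₂s₁} + t^{-1/2}T_{s₁s₂} + t^{-1/2}T_{s₂s₁} + t⁻¹T_{s₁} + t⁻¹T_{s₂} + t^{-3/2}`. -/
def one0 : A.H :=
  ((A.T1 * A.T2 * A.T1 : A.Hˣ) : A.H)
    + algebraMap A.K A.H ((A.tsq⁻¹ : A.Kˣ) : A.K) *
        (((A.T1 * A.T2 : A.Hˣ) : A.H) + ((A.T2 * A.T1 : A.Hˣ) : A.H))
    + algebraMap A.K A.H (((A.tsq⁻¹ : A.Kˣ) : A.K) ^ 2) * ((A.T1 : A.H) + (A.T2 : A.H))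
    + algebraMap A.K A.H (((A.tsq⁻¹ : A.Kˣ) : A.K) ^ 3)

/-- `X^ρ = X^{ω₁+ω₂}`. -/
def Xρ : A.Hˣ := A.X1 * A.X2
/-- `X^{s₁ρ}`, `s₁ρ = -ω₁+2ω₂`. -/
def Xs1ρ : A.Hˣ := A.X1⁻¹ * A.X2 * A.X2
/-- `X^{s₂ρ}`, `s₂ρ = 2ω₁-ω₂`. -/
def Xs2ρ : A.Hˣ := A.X1 * A.X1 * A.X2⁻¹
/-- `X^{s₁s₂ρ}`, `s₁s₂ρ = -2ω₁+ω₂`. -/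
def Xs1s2ρ : A.Hˣ := A.X1⁻¹ * A.X1⁻¹ * A.X2
/-- `X^{s₂s₁ρ}`, `s₂s₁ρ = ω₁-2ω₂`. -/
def Xs2s1ρ : A.Hˣ := A.X1 * A.X2⁻¹ * A.X2⁻¹
/-- `X^{w₀ρ} = X^{-ρ}`. -/
def Xw0ρ : A.Hˣ := A.X1⁻¹ * A.X2⁻¹

/-- `Y^{α₁^∨}`, `α₁^∨ = 2ω₁^∨-ω₂^∨`. -/
def Yα1 : A.Hˣ := A.Y1 * A.Y1 * A.Y2⁻¹

/-- `Y^{α₂^∨}`, `α₂^∨ = -ω₁^∨+2ω₂^∨`. -/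
def Yα2 : A.Hˣ := A.Y1⁻¹ * A.Y2 * A.Y2

/-- The intertwiner `τ₁^∨ = T₁^∨ + t^{-1/2}(1−t)/(1−Y^{-α₁^∨})`. -/
def tau1 : A.H :=
  (A.T1 : A.H) + algebraMap A.K A.H A.tfac * Ring.inverse (1 - ((A.Yα1⁻¹ : A.Hˣ) : A.H))

/-- The intertwiner `τ₂^∨ = T₂^∨ + t^{-1/2}(1−t)/(1−Y^{-α₂^∨})`. -/
def tau2 : A.H :=
  (A.T2 : A.H) + algebraMap A.K A.H A.tfac * Ring.inverse (1 - ((A.Yα2⁻¹ : A.Hˣ) : A.H))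

end A2DAHARep

section helpers
variable {G : Type*} [Group G]

theorem aux_comm_inv {a b : G} (h : a * b = b * a) : a * b⁻¹ = b⁻¹ * a := by
  rw [eq_inv_mul_iff_mul_eq, ← mul_assoc, ← h, mul_assoc, mul_inv_cancel, mul_one]

/-- `T X^ρ` type move. -/
theorem aux_move1 {T X1 X2 : G} (h : T * X1 * T = X1⁻¹ * X2) (hT : T * X2 = X2 * T) :
    T * (X1 * X2) = X1⁻¹ * X2 * X2 * T⁻¹ := by
  have : T * X1 = X1⁻¹ * X2 * T⁻¹ := by rw [← h]; group
  calc T * (X1 * X2) = (T * X1) * X2 := by group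
    _ = X1⁻¹ * X2 * T⁻¹ * X2 := by rw [this]
    _ = X1⁻¹ * X2 * (T⁻¹ * (X2 * T) * T⁻¹) := by group
    _ = _ := by rw [← hT]; group

theorem aux_move5 {T X1 X2 : G} (h : T * X1 * T = X1⁻¹ * X2) (hT : T * X2 = X2 * T) :
    T * (X1 * X2⁻¹ * X2⁻¹) = X1⁻¹ * X2⁻¹ * T⁻¹ := by
  have : T * X1 = X1⁻¹ * X2 * T⁻¹ := by rw [← h]; group
  have h3 : T⁻¹ * X2⁻¹ = X2⁻¹ * T⁻¹ := by
    rw [← mul_inv_rev, ← mul_inv_rev, hT]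
  calc T * (X1 * X2⁻¹ * X2⁻¹) = (T * X1) * X2⁻¹ * X2⁻¹ := by group
    _ = X1⁻¹ * X2 * (T⁻¹ * X2⁻¹) * X2⁻¹ := by rw [this]; group
    _ = X1⁻¹ * X2⁻¹ * T⁻¹ := by rw [h3, mul_assoc, mul_assoc, mul_assoc, h3]; group

theorem aux_move3 {T X1 X2 : G} (h : T * X1 * T = X1⁻¹ * X2) (hT : T * X2 = X2 * T)
    (hX : X1 * X2 = X2 * X1) :
    X1⁻¹ * X2 * T * (X1 * X2⁻¹) = X1⁻¹ * X1⁻¹ * X2 * T⁻¹ := by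
  have : T * X1 = X1⁻¹ * X2 * T⁻¹ := by rw [← h]; group
  have h3 : T⁻¹ * X2⁻¹ = X2⁻¹ * T⁻¹ := by
    rw [← mul_inv_rev, ← mul_inv_rev, hT]
  have h4 : X2 * X1⁻¹ = X1⁻¹ * X2 := aux_comm_inv hX.symm
  calc X1⁻¹ * X2 * T * (X1 * X2⁻¹) = X1⁻¹ * X2 * (T * X1) * X2⁻¹ := by group
    _ = X1⁻¹ * (X2 * X1⁻¹) * X2 * (T⁻¹ * X2⁻¹) := by rw [this]; group
    _ = _ := by rw [h3, h4]; group

theorem aux_move3' {T X1 X2 : G} (h : T * X1 * T = X1⁻¹ * X2) :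
    T * (X1 * X1 * X2⁻¹) = X1⁻¹ * X2 * T⁻¹ * (X1 * X2⁻¹) := by
  rw [← h]; group

theorem aux_g1 {g z X1 X2 : G} (h1 : g * X1 = z * (X1⁻¹ * X2 * g))
    (h2 : g * X2 = z ^ 2 * (X1⁻¹ * g)) (hz : ∀ a, z * a = a * z)
    (hX : X1 * X2 = X2 * X1) :
    z ^ 3 * (g * (X1 * X2⁻¹ * X2⁻¹)) = X1 * X2 * g := by
  have h3 : g * X1 * g⁻¹ = z * (X1⁻¹ * X2) := by rw [h1]; group
  have h4 : g * X2 * g⁻¹ = z ^ 2 * X1⁻¹ := by rw [h2]; group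
  have hz2 : ∀ a, z ^ 2 * a = a * z ^ 2 := fun a => by
    rw [pow_two, mul_assoc, hz a, ← mul_assoc, hz a, mul_assoc]
  have h5 : g * X2⁻¹ * g⁻¹ = X1 * (z ^ 2)⁻¹ := by
    rw [show g * X2⁻¹ * g⁻¹ = (g * X2 * g⁻¹)⁻¹ by group, h4]; group
  have hx : X2 * X1 = X1 * X2 := hX.symm
  calc z ^ 3 * (g * (X1 * X2⁻¹ * X2⁻¹))
      = z ^ 3 * ((g * X1 * g⁻¹) * (g * X2⁻¹ * g⁻¹) * (g * X2⁻¹ * g⁻¹)) * g := by group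
    _ = z ^ 2 * (z * z * (X1⁻¹ * (X2 * X1) * (z ^ 2)⁻¹ * X1 * (z ^ 2)⁻¹)) * g := by
      rw [h3, h5]; group
    _ = z ^ 2 * (z ^ 2 * (X2 * (z ^ 2)⁻¹ * X1 * (z ^ 2)⁻¹)) * g := by
      rw [hx]; group
    _ = z ^ 2 * (X2 * z ^ 2 * (z ^ 2)⁻¹ * X1 * (z ^ 2)⁻¹) * g := by
      rw [← hz2 X2]; group
    _ = z ^ 2 * (X2 * X1) * (z ^ 2)⁻¹ * g := by group
    _ = _ := by rw [hz2, hX]; group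

theorem aux_g2 {g z X1 X2 : G} (h1 : g * X1 = z * (X1⁻¹ * X2 * g))
    (h2 : g * X2 = z ^ 2 * (X1⁻¹ * g)) (hz : ∀ a, z * a = a * z)
    (hX : X1 * X2 = X2 * X1) :
    g * (X1⁻¹ * X1⁻¹ * X2) = X1 * X2⁻¹ * X2⁻¹ * g := by
  have h3 : g * X1 * g⁻¹ = z * (X1⁻¹ * X2) := by rw [h1]; group
  have h4 : g * X2 * g⁻¹ = z ^ 2 * X1⁻¹ := by rw [h2]; group
  have h5 : g * X1⁻¹ * g⁻¹ = X2⁻¹ * X1 * z⁻¹ := by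
    rw [show g * X1⁻¹ * g⁻¹ = (g * X1 * g⁻¹)⁻¹ by group, h3]; group
  have hx : X1 * X2⁻¹ = X2⁻¹ * X1 := aux_comm_inv hX
  have hzi : ∀ a, z⁻¹ * a = a * z⁻¹ := fun a => (aux_comm_inv (hz a).symm).symm
  calc g * (X1⁻¹ * X1⁻¹ * X2)
      = ((g * X1⁻¹ * g⁻¹) * (g * X1⁻¹ * g⁻¹) * (g * X2 * g⁻¹)) * g := by group
    _ = X2⁻¹ * X1 * (z⁻¹ * (X2⁻¹ * X1)) * z * X1⁻¹ * g := by
      rw [h5, h4]; group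
    _ = X2⁻¹ * (X1 * X2⁻¹) * g := by rw [hzi]; group
    _ = (X2⁻¹ * X1) * X2⁻¹ * g := by group
    _ = _ := by rw [← hx]

/-- `Y₁T₂ = T₂Y₁`. -/
theorem aux_Y1T2 {g T1 T2 : G} (hb : T1 * T2 * T1 = T2 * T1 * T2)
    (hg1 : g * T1 * g⁻¹ = T2) :
    g * T2 * T1 * T2 = T2 * (g * T2 * T1) := by
  have : g * T1 = T2 * g := by rw [← hg1]; group
  calc g * T2 * T1 * T2 = g * (T2 * T1 * T2) := by group
    _ = (g * T1) * T2 * T1 := by rw [← hb]; group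
    _ = _ := by rw [this]; group

/-- `Y₂T₂⁻¹Y₂ = T₂Y₁`. -/
theorem aux_Y2T2 {g T1 T2 : G} (hb : T1 * T2 * T1 = T2 * T1 * T2)
    (hg1 : g * T1 * g⁻¹ = T2) (hg3 : g * g * g = 1) :
    (g * g * T1 * T2) * T2⁻¹ * (g * g * T1 * T2) = T2 * (g * T2 * T1) := by
  have h1 : T2 * g = g * T1 := by rw [← hg1]; group
  calc (g * g * T1 * T2) * T2⁻¹ * (g * g * T1 * T2)
      = g * (g * T1) * g * g * T1 * T2 := by group
    _ = g * T2 * (g * g * g) * T1 * T2 := by rw [← h1]; group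
    _ = g * (T2 * T1 * T2) := by rw [hg3]; group
    _ = (g * T1) * T2 * T1 := by rw [← hb]; group
    _ = _ := by rw [← h1]; group

end helpers

namespace A2DAHARep
variable (A : A2DAHARep)

/-- The `K`-module structure on `M`. -/
@[reducible] def modK : Module A.K A.M := Module.compHom A.M (algebraMap A.K A.H)
attribute [local instance] modK

theorem alg_smul (k : A.K) (m : A.M) : algebraMap A.K A.H k • m = k • m := rfl

theorem smul_K (h : A.H) (k : A.K) (m : A.M) : h • (k • m) = k • (h • m) := by
  rw [← alg_smul, ← alg_smul, smul_smul, smul_smul, Algebra.commutes]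

theorem ring_inv_smul {y : A.H} {k : A.K} {m : A.M} (hy : IsUnit y) (hk : IsUnit k)
    (h : y • m = k • m) : Ring.inverse y • m = Ring.inverse k • m := by
  have h1 : m = Ring.inverse k • (k • m) := by
    rw [smul_smul, Ring.inverse_mul_cancel _ hk, one_smul]
  calc Ring.inverse y • m = Ring.inverse y • (Ring.inverse k • (k • m)) := by rw [← h1]
    _ = Ring.inverse k • m := by
      rw [← h, smul_K, smul_smul, Ring.inverse_mul_cancel _ hy, one_smul]

/-- `t^{1/2} - t^{-1/2}`. -/
def cc : A.K := (A.tsq : A.K) - ((A.tsq⁻¹ : A.Kˣ) : A.K)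

theorem s_si : (A.tsq : A.K) * ((A.tsq⁻¹ : A.Kˣ) : A.K) = 1 := by simp

theorem inv_of_quad {T : A.Hˣ} (h : ((T : A.H)) ^ 2 = algebraMap A.K A.H A.cc * (T : A.H) + 1) :
    ((T⁻¹ : A.Hˣ) : A.H) = (T : A.H) - algebraMap A.K A.H A.cc := by
  have : ((T : A.H) - algebraMap A.K A.H A.cc) * (T : A.H) = 1 := by
    rw [sub_mul, ← pow_two, h]; abel
  rw [← mul_one ((T⁻¹ : A.Hˣ) : A.H)]
  calc _ = ((T : A.H) - algebraMap A.K A.H A.cc) * (T : A.H) * ((T⁻¹ : A.Hˣ) : A.H) := by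
        rw [this]; simp
    _ = _ := by rw [mul_assoc]; simp

theorem inv_smul_of {T : A.Hˣ} {m : A.M} {k : A.Kˣ} (h : (T : A.H) • m = (k : A.K) • m) :
    ((T⁻¹ : A.Hˣ) : A.H) • m = ((k⁻¹ : A.Kˣ) : A.K) • m := by
  have h1 : m = ((k⁻¹ : A.Kˣ) : A.K) • ((T : A.H) • m) := by
    rw [h, smul_smul]; simp
  conv_lhs => rw [h1]
  rw [smul_K, smul_smul]; simp

theorem Tone1 : (A.T1 : A.H) • A.one = (A.tsq : A.K) • A.one := A.T1_one
theorem Tone2 : (A.T2 : A.H) • A.one = (A.tsq : A.K) • A.one := A.T2_one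

/-- from a move to a vector identity -/
theorem vec_move {T X X' : A.Hˣ} (h : T * X = X' * T⁻¹)
    (hT : (T : A.H) • A.one = (A.tsq : A.K) • A.one) :
    (T : A.H) • ((X : A.H) • A.one) = ((A.tsq⁻¹ : A.Kˣ) : A.K) • ((X' : A.H) • A.one) := by
  rw [smul_smul, ← Units.val_mul, h, Units.val_mul, mul_smul, A.inv_smul_of hT, smul_K]

theorem vec_move3 {T X X' P Q : A.Hˣ} (h : T * X = P * T⁻¹ * Q) (h' : P * T * Q = X' * T⁻¹)
    (hPQ : P * Q = 1)
    (hq : ((T : A.H)) ^ 2 = algebraMap A.K A.H A.cc * (T : A.H) + 1)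
    (hT : (T : A.H) • A.one = (A.tsq : A.K) • A.one) :
    (T : A.H) • ((X : A.H) • A.one)
      = ((A.tsq⁻¹ : A.Kˣ) : A.K) • ((X' : A.H) • A.one) - A.cc • A.one := by
  have e : ((T * X : A.Hˣ) : A.H) = ((X' * T⁻¹ : A.Hˣ) : A.H) - algebraMap A.K A.H A.cc := by
    rw [h, ← h', Units.val_mul, Units.val_mul, A.inv_of_quad hq, mul_sub, sub_mul,
      Units.val_mul, Units.val_mul, ← Algebra.commutes, mul_assoc (algebraMap A.K A.H A.cc),
      ← Units.val_mul P Q, hPQ]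
    simp
  rw [smul_smul, ← Units.val_mul, e, sub_smul, Units.val_mul, mul_smul, A.inv_smul_of hT, smul_K,
    alg_smul]

theorem L1 : (A.T2 : A.H) • ((A.Xρ : A.H) • A.one)
    = ((A.tsq⁻¹ : A.Kˣ) : A.K) • ((A.Xs2ρ : A.H) • A.one) := by
  apply A.vec_move _ A.Tone2
  have h := aux_move1 (T := A.T2) (X1 := A.X2) (X2 := A.X1)
    (by rw [A.rel_T2X2, aux_comm_inv A.rel_X]) A.rel_T2X1
  unfold Xρ Xs2ρ
  rw [A.rel_X, h, mul_assoc A.X1 A.X1, aux_comm_inv A.rel_X, ← mul_assoc A.X1,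
    aux_comm_inv A.rel_X]

theorem L2 : (A.T1 : A.H) • ((A.Xρ : A.H) • A.one)
    = ((A.tsq⁻¹ : A.Kˣ) : A.K) • ((A.Xs1ρ : A.H) • A.one) :=
  A.vec_move (aux_move1 A.rel_T1X1 A.rel_T1X2) A.Tone1

theorem L3 : (A.T1 : A.H) • ((A.Xs2ρ : A.H) • A.one)
    = ((A.tsq⁻¹ : A.Kˣ) : A.K) • ((A.Xs1s2ρ : A.H) • A.one) - A.cc • A.one :=
  A.vec_move3 (aux_move3' A.rel_T1X1) (aux_move3 A.rel_T1X1 A.rel_T1X2 A.rel_X)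
    (by rw [aux_comm_inv A.rel_X]; group) A.quad1 A.Tone1

theorem L4 : (A.T2 : A.H) • ((A.Xs1ρ : A.H) • A.one)
    = ((A.tsq⁻¹ : A.Kˣ) : A.K) • ((A.Xs2s1ρ : A.H) • A.one) - A.cc • A.one := by
  have hr : A.T2 * A.X2 * A.T2 = A.X2⁻¹ * A.X1 := by rw [A.rel_T2X2, aux_comm_inv A.rel_X]
  have hx : A.X2 * A.X1⁻¹ = A.X1⁻¹ * A.X2 := aux_comm_inv A.rel_X.symm
  have hx' : A.X1 * A.X2⁻¹ = A.X2⁻¹ * A.X1 := aux_comm_inv A.rel_X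
  have e1 : A.Xs1ρ = A.X2 * A.X2 * A.X1⁻¹ := by
    unfold Xs1ρ; rw [← hx, mul_assoc, mul_assoc, hx]
  have e2 : A.Xs2s1ρ = A.X2⁻¹ * A.X2⁻¹ * A.X1 := by
    unfold Xs2s1ρ; rw [hx', mul_assoc, mul_assoc, hx']
  rw [e1, e2]
  exact A.vec_move3 (aux_move3' hr) (aux_move3 hr A.rel_T2X1 A.rel_X.symm)
    (by rw [hx]; group) A.quad2 A.Tone2

theorem L5 : (A.T1 : A.H) • ((A.Xs2s1ρ : A.H) • A.one)
    = ((A.tsq⁻¹ : A.Kˣ) : A.K) • ((A.Xw0ρ : A.H) • A.one) :=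
  A.vec_move (aux_move5 A.rel_T1X1 A.rel_T1X2) A.Tone1

theorem L6 : (A.Xρ : A.H) • ((A.Xw0ρ : A.H) • A.one) = A.one := by
  rw [smul_smul, ← Units.val_mul]
  have : A.Xρ * A.Xw0ρ = 1 := by unfold Xρ Xw0ρ; rw [A.rel_X]; group
  rw [this]; simp

/-- `q^{1/3}` as a unit of `H`. -/
def zH : A.Hˣ := Units.map (algebraMap A.K A.H : A.K →* A.H) A.qc

theorem zH_val : (A.zH : A.H) = algebraMap A.K A.H (A.qc : A.K) := rfl

theorem zH_comm (a : A.Hˣ) : A.zH * a = a * A.zH := by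
  apply Units.ext
  simp only [Units.val_mul, zH_val]
  exact Algebra.commutes _ _

theorem gX1' : A.g * A.X1 = A.zH * (A.X1⁻¹ * A.X2 * A.g) := by
  apply Units.ext
  rw [A.rel_gX1, Units.val_mul A.zH, zH_val]

theorem gX2' : A.g * A.X2 = A.zH ^ 2 * (A.X1⁻¹ * A.g) := by
  apply Units.ext
  rw [A.rel_gX2, Units.val_mul (A.zH ^ 2), Units.val_pow_eq_pow_val, zH_val, map_pow]

theorem L7 : A.q • ((A.g : A.H) • ((A.Xs2s1ρ : A.H) • A.one)) = (A.Xρ : A.H) • A.one := by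
  have h := aux_g1 A.gX1' A.gX2' A.zH_comm A.rel_X
  have h' : algebraMap A.K A.H A.q * ((A.g : A.H) * (A.Xs2s1ρ : A.H)) = (A.Xρ : A.H) * A.g := by
    have := congrArg Units.val h
    rw [Units.val_mul, Units.val_pow_eq_pow_val, zH_val, ← map_pow, Units.val_mul,
      Units.val_mul (A.X1 * A.X2)] at this
    exact this
  rw [← alg_smul, smul_smul, smul_smul, mul_assoc, h', mul_smul, A.g_one]

theorem L8 : (A.g : A.H) • ((A.Xs1s2ρ : A.H) • A.one) = (A.Xs2s1ρ : A.H) • A.one := by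
  have h : A.g * A.Xs1s2ρ = A.Xs2s1ρ * A.g := aux_g2 A.gX1' A.gX2' A.zH_comm A.rel_X
  rw [smul_smul, ← Units.val_mul, h, Units.val_mul, mul_smul, A.g_one]

theorem T2T1ρ : (A.T2 : A.H) • (A.T1 : A.H) • ((A.Xρ : A.H) • A.one)
    = (((A.tsq⁻¹ : A.Kˣ) : A.K) ^ 2) • ((A.Xs2s1ρ : A.H) • A.one)
      - (((A.tsq⁻¹ : A.Kˣ) : A.K) * A.cc) • A.one := by
  rw [L2, smul_K, L4]
  generalize (A.Xs2s1ρ : A.H) • A.one = v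
  module

theorem T1T2ρ : (A.T1 : A.H) • (A.T2 : A.H) • ((A.Xρ : A.H) • A.one)
    = (((A.tsq⁻¹ : A.Kˣ) : A.K) ^ 2) • ((A.Xs1s2ρ : A.H) • A.one)
      - (((A.tsq⁻¹ : A.Kˣ) : A.K) * A.cc) • A.one := by
  rw [L1, smul_K, L3]
  generalize (A.Xs1s2ρ : A.H) • A.one = v
  module

theorem T0v_one : (A.T0v : A.H) • A.one
    = ((A.tsq : A.K) ^ 3) • ((A.Xρ : A.H) • A.one) + A.cc • A.one := by
  have key : ((A.T0v⁻¹ : A.Hˣ) : A.H) •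
      (((A.tsq : A.K) ^ 3) • ((A.Xρ : A.H) • A.one) + A.cc • A.one) = A.one := by
    have e : A.T0v⁻¹ = A.Xρ * (A.T1 * (A.T2 * A.T1)) := by unfold T0v Xρ; group
    have e1 : (A.T1 : A.H) • (A.T2 : A.H) • (A.T1 : A.H) • ((A.Xρ : A.H) • A.one)
        = (((A.tsq⁻¹ : A.Kˣ) : A.K) ^ 3) • ((A.Xw0ρ : A.H) • A.one) - A.cc • A.one := by
      rw [T2T1ρ, smul_sub, smul_K, smul_K, L5, Tone1]
      generalize (A.Xw0ρ : A.H) • A.one = v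
      match_scalars
      · ring
      · linear_combination (-A.cc) * A.s_si
    rw [e]
    simp only [Units.val_mul, mul_smul, smul_add, smul_K, Tone1, Tone2, e1, smul_sub, L6]
    have := A.s_si
    generalize (A.Xρ : A.H) • A.one = v
    match_scalars
    · linear_combination (((A.tsq : A.K) * ((A.tsq⁻¹ : A.Kˣ) : A.K)) ^ 2
        + ((A.tsq : A.K) * ((A.tsq⁻¹ : A.Kˣ) : A.K)) + 1) * this
    · ring
  conv_lhs => rw [← key]
  rw [smul_smul, ← Units.val_mul]; simp

/-- `(1-t)q/(1-t²q)` -/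
def aa : A.K := (1 - A.t) * A.q * Ring.inverse (1 - A.t ^ 2 * A.q)

/-- `X^ρ + (1-t)q/(1-t²q)`. -/
def m0 : A.M := (A.Xρ : A.H) • A.one + A.aa • A.one

theorem g_one' : (A.g : A.H) • A.one = A.one := A.g_one

theorem q_unit : IsUnit A.q := by unfold q; exact A.qc.isUnit.pow 3

theorem t_unit : IsUnit A.t := by unfold t; exact A.tsq.isUnit.pow 2

theorem smul_cancel {k : A.K} (hk : IsUnit k) {m n : A.M} (h : k • m = k • n) : m = n := by
  have := congrArg (fun x => Ring.inverse k • x) h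
  simpa [smul_smul, Ring.inverse_mul_cancel _ hk] using this

theorem aa_eq (hK0 : IsUnit ((1 : A.K) - A.t ^ 2 * A.q)) :
    A.aa * (1 - A.t ^ 2 * A.q) = (1 - A.t) * A.q := by
  unfold aa; rw [mul_assoc, Ring.inverse_mul_cancel _ hK0, mul_one]

theorem Y1_m0 (hK0 : IsUnit ((1 : A.K) - A.t ^ 2 * A.q)) :
    (A.q * A.t) • ((A.Y1 : A.H) • A.m0) = A.m0 := by
  have ha := A.aa_eq hK0
  have hs := A.s_si
  have hg := A.L7
  have e : (A.Y1 : A.H) • A.m0 = (A.g : A.H) • (A.T2 : A.H) • (A.T1 : A.H) • A.m0 := by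
    unfold Y1; simp only [Units.val_mul, mul_smul]
  rw [e]
  unfold m0
  simp only [smul_add, smul_K, T2T1ρ, smul_sub, Tone1, Tone2, g_one']
  rw [← hg]
  generalize (A.g : A.H) • (A.Xs2s1ρ : A.H) • A.one = v
  unfold t cc at *
  generalize (A.tsq : A.K) = s at *
  generalize ((A.tsq⁻¹ : A.Kˣ) : A.K) = r at *
  match_scalars
  · linear_combination A.q * (s * r + 1) * hs
  · linear_combination (-1 : A.K) * ha - A.q * (s ^ 2 - s * r - 1) * hs

theorem Y2_m0 (hK0 : IsUnit ((1 : A.K) - A.t ^ 2 * A.q)) :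
    (A.q * A.t) • ((A.Y2 : A.H) • A.m0) = A.m0 := by
  have ha := A.aa_eq hK0
  have hs := A.s_si
  have hg := A.L7
  have e : (A.Y2 : A.H) • A.m0
      = (A.g : A.H) • (A.g : A.H) • (A.T1 : A.H) • (A.T2 : A.H) • A.m0 := by
    unfold Y2; simp only [Units.val_mul, mul_smul]
  rw [e]
  unfold m0
  simp only [smul_add, smul_K, T1T2ρ, smul_sub, Tone1, Tone2, g_one', L8]
  rw [← hg]
  generalize (A.g : A.H) • (A.Xs2s1ρ : A.H) • A.one = v
  unfold t cc at *
  generalize (A.tsq : A.K) = s at *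
  generalize ((A.tsq⁻¹ : A.Kˣ) : A.K) = r at *
  match_scalars
  · linear_combination A.q * (s * r + 1) * hs
  · linear_combination (-1 : A.K) * ha - A.q * (s ^ 2 - s * r - 1) * hs

theorem inv_of_smul {k : A.K} {Y : A.Hˣ} {m : A.M} (h : k • ((Y : A.H) • m) = m) :
    ((Y⁻¹ : A.Hˣ) : A.H) • m = k • m := by
  conv_lhs => rw [← h]
  rw [smul_K, smul_smul]; simp

theorem tfac_eq : A.tfac = - A.cc := by
  unfold tfac cc t; linear_combination (-(A.tsq : A.K)) * A.s_si

theorem tau0_one (h0 : IsUnit ((1 : A.H) - A.Yma0))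
    (hK0 : IsUnit ((1 : A.K) - A.t ^ 2 * A.q)) :
    A.tau0 • A.one = ((A.tsq : A.K) ^ 3) • A.m0 := by
  have ha := A.aa_eq hK0
  have hs := A.s_si
  have e : (1 - A.Yma0) • A.one = (1 - A.t ^ 2 * A.q) • A.one := by
    have : A.Yma0 • A.one = (A.t ^ 2 * A.q) • A.one := by
      unfold Yma0 Yφ Y1 Y2
      simp only [Units.val_mul, mul_smul, alg_smul, smul_K, Tone1, Tone2, g_one']
      unfold t
      module
    rw [sub_smul, this, sub_smul, one_smul, one_smul]
  unfold tau0
  rw [add_smul, mul_smul, A.ring_inv_smul h0 hK0 e, T0v_one, alg_smul, tfac_eq]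
  unfold m0 aa
  generalize (A.Xρ : A.H) • A.one = v
  have hi := Ring.inverse_mul_cancel _ hK0
  generalize Ring.inverse (1 - A.t ^ 2 * A.q) = u at *
  unfold t cc at *
  generalize (A.tsq : A.K) = s at *
  generalize ((A.tsq⁻¹ : A.Kˣ) : A.K) = r at *
  match_scalars
  · ring
  · linear_combination (-(s - r)) * hi + u * A.q * s ^ 3 * hs

/-- `τ₂^∨ m₀`. -/
def n0 : A.M := (A.T2 : A.H) • A.m0 + (A.tfac * Ring.inverse (1 - A.t * A.q)) • A.m0

theorem tau2_m0 (h2 : IsUnit ((1 : A.H) - ((A.Yα2⁻¹ : A.Hˣ) : A.H)))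
    (hK0 : IsUnit ((1 : A.K) - A.t ^ 2 * A.q)) (hK1 : IsUnit ((1 : A.K) - A.t * A.q)) :
    A.tau2 • A.m0 = A.n0 := by
  have hy2 := A.inv_of_smul (A.Y2_m0 hK0)
  have hy1 := A.Y1_m0 hK0
  have e : (1 - ((A.Yα2⁻¹ : A.Hˣ) : A.H)) • A.m0 = (1 - A.t * A.q) • A.m0 := by
    have : ((A.Yα2⁻¹ : A.Hˣ) : A.H) • A.m0 = (A.t * A.q) • A.m0 := by
      have e1 : A.Yα2⁻¹ = A.Y2⁻¹ * (A.Y2⁻¹ * A.Y1) := by unfold Yα2; group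
      rw [e1, Units.val_mul, Units.val_mul, mul_smul, mul_smul]
      apply A.smul_cancel (A.q_unit.mul A.t_unit)
      rw [← smul_K, ← smul_K, hy1, hy2, smul_K, hy2]
      module
    rw [sub_smul, this, sub_smul, one_smul, one_smul]
  unfold tau2 n0
  rw [add_smul, mul_smul, A.ring_inv_smul h2 hK1 e, alg_smul, smul_smul]

theorem Y1_n0 (hK0 : IsUnit ((1 : A.K) - A.t ^ 2 * A.q)) :
    (A.q * A.t) • ((A.Y1 : A.H) • A.n0) = A.n0 := by
  have h : A.Y1 * A.T2 = A.T2 * A.Y1 := aux_Y1T2 A.rel_br12 A.rel_gT1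
  unfold n0
  have e : (A.Y1 : A.H) • (A.T2 : A.H) • A.m0 = (A.T2 : A.H) • (A.Y1 : A.H) • A.m0 := by
    rw [smul_smul, smul_smul, ← Units.val_mul, h, Units.val_mul]
  rw [smul_add, e, smul_K, smul_add, ← smul_K, A.Y1_m0 hK0, smul_comm, A.Y1_m0 hK0]

theorem Y2_n0 (hK0 : IsUnit ((1 : A.K) - A.t ^ 2 * A.q)) (hK1 : IsUnit ((1 : A.K) - A.t * A.q)) :
    (A.Y2 : A.H) • A.n0 = A.n0 := by
  have h : A.Y2 * A.T2⁻¹ * A.Y2 = A.T2 * A.Y1 := aux_Y2T2 A.rel_br12 A.rel_gT1 A.rel_g3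
  have hU := A.q_unit.mul A.t_unit
  have e0 : (A.Y2 : A.H) • ((A.T2⁻¹ : A.Hˣ) : A.H) • A.m0 = (A.T2 : A.H) • A.m0 := by
    apply A.smul_cancel hU
    have e1 : (A.Y2 : A.H) • ((A.T2⁻¹ : A.Hˣ) : A.H) • (A.Y2 : A.H) • A.m0
        = (A.T2 : A.H) • (A.Y1 : A.H) • A.m0 := by
      rw [← mul_smul, ← mul_smul, ← mul_smul, ← Units.val_mul, ← Units.val_mul, ← Units.val_mul, h]
    have e2 := congrArg (fun x => (A.q * A.t) • x) e1
    rw [← smul_K, ← smul_K, A.Y2_m0 hK0, ← smul_K, A.Y1_m0 hK0] at e2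
    rw [e2]
  have e3 : (A.T2 : A.H) • A.m0 = ((A.T2⁻¹ : A.Hˣ) : A.H) • A.m0 + A.cc • A.m0 := by
    rw [A.inv_of_quad A.quad2, sub_smul, alg_smul]; abel
  apply A.smul_cancel hU
  have hY := A.Y2_m0 hK0
  have e4 : (A.Y2 : A.H) • A.n0 = (A.T2 : A.H) • A.m0
      + (A.cc + A.tfac * Ring.inverse (1 - A.t * A.q)) • ((A.Y2 : A.H) • A.m0) := by
    unfold n0
    conv_lhs => rw [e3]
    rw [smul_add, smul_add, e0, smul_K, smul_K]
    generalize (A.Y2 : A.H) • A.m0 = v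
    generalize (A.T2 : A.H) • A.m0 = v'
    module
  rw [e4, smul_add, smul_comm (A.q * A.t) (A.cc + A.tfac * Ring.inverse (1 - A.t * A.q)), hY]
  unfold n0
  generalize (A.T2 : A.H) • A.m0 = v'
  have hi := Ring.inverse_mul_cancel _ hK1
  rw [tfac_eq]
  generalize Ring.inverse (1 - A.t * A.q) = u at *
  match_scalars
  · ring
  · linear_combination (-A.cc) * hi

theorem tau1_n0 (h1 : IsUnit ((1 : A.H) - ((A.Yα1⁻¹ : A.Hˣ) : A.H)))
    (hK0 : IsUnit ((1 : A.K) - A.t ^ 2 * A.q)) (hK1 : IsUnit ((1 : A.K) - A.t * A.q))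
    (hK2 : IsUnit ((1 : A.K) - A.t ^ 2 * A.q ^ 2)) :
    A.tau1 • A.n0
      = (A.T1 : A.H) • A.n0 + (A.tfac * Ring.inverse (1 - A.t ^ 2 * A.q ^ 2)) • A.n0 := by
  have hy1 := A.inv_of_smul (A.Y1_n0 hK0)
  have e : (1 - ((A.Yα1⁻¹ : A.Hˣ) : A.H)) • A.n0 = (1 - A.t ^ 2 * A.q ^ 2) • A.n0 := by
    have : ((A.Yα1⁻¹ : A.Hˣ) : A.H) • A.n0 = (A.t ^ 2 * A.q ^ 2) • A.n0 := by
      have e1 : A.Yα1⁻¹ = A.Y2 * (A.Y1⁻¹ * A.Y1⁻¹) := by unfold Yα1; group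
      rw [e1, Units.val_mul, Units.val_mul, mul_smul, mul_smul, hy1, smul_K, hy1, smul_K, smul_K,
        A.Y2_n0 hK0 hK1]
      module
    rw [sub_smul, this, sub_smul, one_smul, one_smul]
  unfold tau1
  rw [add_smul, mul_smul, A.ring_inv_smul h1 hK2 e, alg_smul, smul_smul]

end A2DAHARep

open A2DAHARep
attribute [local instance] A2DAHARep.modK

/-- in the polynomial representation of the type `A₂` double affine Hecke
algebra with equal parameters, the nonsymmetric Macdonald polynomial
`E_{s₁s₂ρ} = τ₁^∨τ₂^∨τ₀^∨·𝟙` for `ρ = α₁+α₂` equals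
`t^{1/2}( X^{s₁s₂ρ} + (1−t)/(1−t²q) + X^{s₁ρ}(1−t)/(1−tq)
  + t((1−t)q/(1−t²q))((1−t)/(1−tq)) + X^{s₂ρ}(1−t)/(1−t²q²)
  + t((1−t)q/(1−t²q))((1−t)/(1−t²q²)) + X^ρ((1−t)/(1−tq))((1−t)/(1−t²q²))
  + ((1−t)q/(1−t²q))((1−t)/(1−tq))((1−t)/(1−t²q²)) )·𝟙`,
where `Y^{-α₀^∨}·𝟙 = t²q·𝟙`, `Y^{-s₀α₂^∨}·𝟙 = tq·𝟙`, `Y^{-s₀s₂α₁^∨}·𝟙 = t²q²·𝟙`. -/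
theorem statement17 (A : A2DAHARep)
    (h0 : IsUnit ((1 : A.H) - A.Yma0))
    (h1 : IsUnit ((1 : A.H) - ((A.Yα1⁻¹ : A.Hˣ) : A.H)))
    (h2 : IsUnit ((1 : A.H) - ((A.Yα2⁻¹ : A.Hˣ) : A.H)))
    (hK0 : IsUnit ((1 : A.K) - A.t ^ 2 * A.q))
    (hK1 : IsUnit ((1 : A.K) - A.t * A.q))
    (hK2 : IsUnit ((1 : A.K) - A.t ^ 2 * A.q ^ 2)) :
    (A.tau1 * A.tau2 * A.tau0) • A.one =
      (algebraMap A.K A.H ((A.tsq : A.K)) *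
        ((A.Xs1s2ρ : A.H)
          + algebraMap A.K A.H ((1 - A.t) * Ring.inverse (1 - A.t ^ 2 * A.q))
          + (A.Xs1ρ : A.H) *
              algebraMap A.K A.H ((1 - A.t) * Ring.inverse (1 - A.t * A.q))
          + algebraMap A.K A.H
              (A.t * ((1 - A.t) * A.q * Ring.inverse (1 - A.t ^ 2 * A.q)) *
                ((1 - A.t) * Ring.inverse (1 - A.t * A.q)))
          + (A.Xs2ρ : A.H) *
              algebraMap A.K A.H ((1 - A.t) * Ring.inverse (1 - A.t ^ 2 * A.q ^ 2))
          + algebraMap A.K A.H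
              (A.t * ((1 - A.t) * A.q * Ring.inverse (1 - A.t ^ 2 * A.q)) *
                ((1 - A.t) * Ring.inverse (1 - A.t ^ 2 * A.q ^ 2)))
          + (A.Xρ : A.H) *
              algebraMap A.K A.H (((1 - A.t) * Ring.inverse (1 - A.t * A.q)) *
                ((1 - A.t) * Ring.inverse (1 - A.t ^ 2 * A.q ^ 2)))
          + algebraMap A.K A.H
              (((1 - A.t) * A.q * Ring.inverse (1 - A.t ^ 2 * A.q)) *
                ((1 - A.t) * Ring.inverse (1 - A.t * A.q)) *
                ((1 - A.t) * Ring.inverse (1 - A.t ^ 2 * A.q ^ 2))))) • A.one := by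
  rw [mul_smul, mul_smul, A.tau0_one h0 hK0, smul_K, A.tau2_m0 h2 hK0 hK1, smul_K,
    A.tau1_n0 h1 hK0 hK1 hK2]
  have hs := A.s_si
  have hi := Ring.inverse_mul_cancel _ hK0
  simp only [mul_smul, add_smul, alg_smul, smul_K]
  unfold n0 m0
  simp only [smul_add, smul_sub, smul_K, L1, L2, L3, Tone1, Tone2, tfac_eq]
  unfold aa
  generalize Ring.inverse (1 - A.t ^ 2 * A.q) = u at *
  generalize Ring.inverse (1 - A.t * A.q) = v at *
  generalize Ring.inverse (1 - A.t ^ 2 * A.q ^ 2) = w at *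
  unfold t cc at *
  generalize (A.tsq : A.K) = s at *
  generalize ((A.tsq⁻¹ : A.Kˣ) : A.K) = r at *
  generalize (A.Xρ : A.H) • A.one = v1
  generalize (A.Xs1ρ : A.H) • A.one = v2
  generalize (A.Xs2ρ : A.H) • A.one = v3
  generalize (A.Xs1s2ρ : A.H) • A.one = v4
  match_scalars
  all_goals clear hK0 hK1 hK2 h0 h1 h2
  all_goals grind

end
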